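/- Lipschitz contraction estimate: Let (Z, d_Z) be a separable metric space, p ∈ [1,∞), and fix z ∈ Z and t ∈ [0,1]. For a (Z,p)-network X = (X, ω_X, μ_X), define X_t = (X ⊔ {⋆}, ω̂_X, (1−t)μ_X + tδ_⋆), where ω̂_X(u,v) = ω_X(u,v) if u, v ∈ X and ω̂_X(u,v) = z otherwise, and δ_⋆ is the Dirac measure at ⋆; define Y_t analogously for a (Z,p)-network Y. Then GW_p^Z(X_t, Y_t) ≤ (1−t)^{2/p} · GW_p^Z(X, Y). -/

import Mathlib

open MeasureTheory

noncomputable section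

/-- The set of couplings of two measures: probability measures on the product
whose marginals are `μ` and `ν`. -/
def Couplings {X Y : Type*} [MeasurableSpace X] [MeasurableSpace Y]
    (μ : Measure X) (ν : Measure Y) : Set (Measure (X × Y)) :=
  {π | IsProbabilityMeasure π ∧ π.map Prod.fst = μ ∧ π.map Prod.snd = ν}

/-- The `p`-distortion of a coupling `π`, for kernels `ωX`, `ωY` valued in a
(pseudo)metric space `Z`. -/
def dis {X Y Z : Type*} [MeasurableSpace X] [MeasurableSpace Y] [PseudoMetricSpace Z]
    (p : ℝ) (ωX : X × X → Z) (ωY : Y × Y → Z) (π : Measure (X × Y)) : ℝ :=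
  (∫ w : X × Y, ∫ w' : X × Y,
      dist (ωX (w.1, w'.1)) (ωY (w.2, w'.2)) ^ p ∂π ∂π) ^ (1 / p)

/-- The `Z`-Gromov–Wasserstein `p`-distance between `(X, ωX, μX)` and `(Y, ωY, μY)`. -/
def GW {X Y Z : Type*} [MeasurableSpace X] [MeasurableSpace Y] [PseudoMetricSpace Z]
    (p : ℝ) (ωX : X × X → Z) (μX : Measure X) (ωY : Y × Y → Z) (μY : Measure Y) : ℝ :=
  (1 / 2) * sInf (dis p ωX ωY '' Couplings μX μY)

/-- `(X, ω, μ)` is a `(Z,p)`-network: `μ` is a Borel probability measure, `ω` is Borel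
measurable, and `∬ d_Z(ω(x,x'), z₀)^p dμ dμ < ∞` for some `z₀`. -/
structure IsNetwork {X Z : Type*} [MeasurableSpace X] [MeasurableSpace Z] [PseudoMetricSpace Z]
    (p : ℝ) (ω : X × X → Z) (μ : Measure X) : Prop where
  prob : IsProbabilityMeasure μ
  meas : Measurable ω
  integ : ∃ z₀ : Z, (∫⁻ x, ∫⁻ x', ENNReal.ofReal (dist (ω (x, x')) z₀ ^ p) ∂μ ∂μ) < ⊤

/-- The kernel `ω̂` on `X ⊔ {⋆}` extending `ω` by the constant value `z`. -/
def hatKernel {X Z : Type*} (ω : X × X → Z) (z : Z) :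
    (X ⊕ Unit) × (X ⊕ Unit) → Z
  | (Sum.inl x, Sum.inl x') => ω (x, x')
  | _ => z

/-- The measure `(1−t)·μ + t·δ_⋆` on `X ⊔ {⋆}`. -/
def mixDirac {X : Type*} [MeasurableSpace X] (μ : Measure X) (t : ℝ) :
    Measure (X ⊕ Unit) :=
  ENNReal.ofReal (1 - t) • μ.map Sum.inl + ENNReal.ofReal t • Measure.dirac (Sum.inr ())

theorem integral_smul_map_add_smul_dirac_of_apply_eq_zero {α β : Type*} [MeasurableSpace α]
    [MeasurableSpace β] {e : α → β} (he : MeasurableEmbedding e) {s : β}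
    (hs : MeasurableSet {s}) (hse : s ∉ Set.range e) (μ : Measure α) (a b : ENNReal)
    {f : β → ℝ} (hf : f s = 0) :
    ∫ x, f x ∂(a • μ.map e + b • Measure.dirac s) = a.toReal * ∫ x, f (e x) ∂μ := by
  have hr := he.measurableSet_range
  rw [← setIntegral_eq_integral_of_ae_compl_eq_zero (s := Set.range e)]
  · have hmap : (μ.map e).restrict (Set.range e) = μ.map e := by
      rw [he.restrict_map]
      simp
    have hdirac : (Measure.dirac s).restrict (Set.range e) = 0 := by
      rw [Measure.restrict_eq_zero, Measure.dirac_apply' _ hr]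
      simp [hse]
    rw [Measure.restrict_add, Measure.restrict_smul, Measure.restrict_smul, hmap, hdirac,
      smul_zero, add_zero, integral_smul_measure, he.integral_map, smul_eq_mul]
  · rw [ae_add_measure_iff]
    constructor
    · refine Measure.ae_smul_measure ?_ a
      filter_upwards [ae_map_mem_range e hr μ] with x hx h
      exact absurd hx h
    · refine Measure.ae_smul_measure ?_ b
      have hmem : ∀ᵐ x ∂Measure.dirac s, x ∈ ({s} : Set β) := (ae_dirac_iff hs).2 rfl
      filter_upwards [hmem] with x hx _
      rw [Set.mem_singleton_iff.1 hx, hf]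

theorem measurableEmbedding_inl {α β : Type*} [MeasurableSpace α] [MeasurableSpace β] :
    MeasurableEmbedding (Sum.inl : α → α ⊕ β) :=
  ⟨Sum.inl_injective, measurable_inl, fun _ hs => hs.inl_image⟩

theorem map_fst_smul_map_prodMap_inl {X Y : Type*} [MeasurableSpace X] [MeasurableSpace Y]
    (π : Measure (X × Y)) (a b : ENNReal) :
    (a • π.map (Prod.map (Sum.inl : X → X ⊕ Unit) (Sum.inl : Y → Y ⊕ Unit)) +
      b • Measure.dirac (Sum.inr (), Sum.inr ())).map Prod.fst =
    a • (π.map Prod.fst).map Sum.inl + b • Measure.dirac (Sum.inr ()) := by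
  rw [Measure.map_add _ _ measurable_fst, Measure.map_smul, Measure.map_smul,
    Measure.map_map measurable_fst (measurable_inl.prodMap measurable_inl),
    Measure.map_map measurable_inl measurable_fst, Measure.map_dirac' measurable_fst]
  rfl

theorem map_snd_smul_map_prodMap_inl {X Y : Type*} [MeasurableSpace X] [MeasurableSpace Y]
    (π : Measure (X × Y)) (a b : ENNReal) :
    (a • π.map (Prod.map (Sum.inl : X → X ⊕ Unit) (Sum.inl : Y → Y ⊕ Unit)) +
      b • Measure.dirac (Sum.inr (), Sum.inr ())).map Prod.snd =
    a • (π.map Prod.snd).map Sum.inl + b • Measure.dirac (Sum.inr ()) := by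
  rw [Measure.map_add _ _ measurable_snd, Measure.map_smul, Measure.map_smul,
    Measure.map_map measurable_snd (measurable_inl.prodMap measurable_inl),
    Measure.map_map measurable_inl measurable_snd, Measure.map_dirac' measurable_snd]
  rfl

/-- The coupling `(1−t)·π + t·δ_(⋆,⋆)` on `(X ⊔ {⋆}) × (Y ⊔ {⋆})`. -/
def hatCoupling {X Y : Type*} [MeasurableSpace X] [MeasurableSpace Y]
    (π : Measure (X × Y)) (t : ℝ) : Measure ((X ⊕ Unit) × (Y ⊕ Unit)) :=
  ENNReal.ofReal (1 - t) • π.map (Prod.map Sum.inl Sum.inl) +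
    ENNReal.ofReal t • Measure.dirac (Sum.inr (), Sum.inr ())

theorem hatCoupling_mem_couplings {X Y : Type*} [MeasurableSpace X] [MeasurableSpace Y]
    {μ : Measure X} {ν : Measure Y} {π : Measure (X × Y)} (hπ : π ∈ Couplings μ ν)
    {t : ℝ} (ht : t ∈ Set.Icc (0 : ℝ) 1) :
    hatCoupling π t ∈ Couplings (mixDirac μ t) (mixDirac ν t) := by
  obtain ⟨hprob, hfst, hsnd⟩ := hπ
  refine ⟨⟨?_⟩, ?_, ?_⟩
  · have : IsProbabilityMeasure
        (π.map (Prod.map (Sum.inl : X → X ⊕ Unit) (Sum.inl : Y → Y ⊕ Unit))) :=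
      Measure.isProbabilityMeasure_map (measurable_inl.prodMap measurable_inl).aemeasurable
    simp only [hatCoupling, Measure.add_apply, Measure.smul_apply, measure_univ, smul_eq_mul,
      mul_one]
    rw [← ENNReal.ofReal_add (sub_nonneg.2 ht.2) ht.1, sub_add_cancel, ENNReal.ofReal_one]
  · rw [hatCoupling, map_fst_smul_map_prodMap_inl, hfst, mixDirac]
  · rw [hatCoupling, map_snd_smul_map_prodMap_inl, hsnd, mixDirac]

theorem dis_hatCoupling {X Y Z : Type*} [MeasurableSpace X] [MeasurableSpace Y]
    [PseudoMetricSpace Z] {p : ℝ} (hp : 0 < p) (z : Z) {t : ℝ} (ht : t ≤ 1)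
    (ωX : X × X → Z) (ωY : Y × Y → Z) (π : Measure (X × Y)) :
    dis p (hatKernel ωX z) (hatKernel ωY z) (hatCoupling π t) =
      (1 - t) ^ (2 / p) * dis p ωX ωY π := by
  have he : MeasurableEmbedding
      (Prod.map (Sum.inl : X → X ⊕ Unit) (Sum.inl : Y → Y ⊕ Unit)) :=
    measurableEmbedding_inl.prodMap measurableEmbedding_inl
  have hs : MeasurableSet {((Sum.inr (), Sum.inr ()) : (X ⊕ Unit) × (Y ⊕ Unit))} := by
    have h1 : MeasurableSet {(Sum.inr () : X ⊕ Unit)} := by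
      simpa [Set.range_unique] using (MeasurableSet.univ (α := Unit)).inr_image (α := X)
    have h2 : MeasurableSet {(Sum.inr () : Y ⊕ Unit)} := by
      simpa [Set.range_unique] using (MeasurableSet.univ (α := Unit)).inr_image (α := Y)
    simpa using h1.prod h2
  have hse : ((Sum.inr (), Sum.inr ()) : (X ⊕ Unit) × (Y ⊕ Unit)) ∉
      Set.range (Prod.map Sum.inl Sum.inl) := by
    rintro ⟨w, hw⟩
    simp [Prod.ext_iff] at hw
  have hright (x : X ⊕ Unit) : hatKernel ωX z (x, Sum.inr ()) = z := by cases x <;> rfl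
  have hright' (y : Y ⊕ Unit) : hatKernel ωY z (y, Sum.inr ()) = z := by cases y <;> rfl
  have ht' : 0 ≤ 1 - t := sub_nonneg.2 ht
  have hinner (w : (X ⊕ Unit) × (Y ⊕ Unit)) :
      ∫ w', dist (hatKernel ωX z (w.1, w'.1)) (hatKernel ωY z (w.2, w'.2)) ^ p
        ∂(hatCoupling π t) =
      (1 - t) * ∫ w' : X × Y, dist (hatKernel ωX z (w.1, Sum.inl w'.1))
        (hatKernel ωY z (w.2, Sum.inl w'.2)) ^ p ∂π := by
    rw [hatCoupling, integral_smul_map_add_smul_dirac_of_apply_eq_zero he hs hse,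
      ENNReal.toReal_ofReal ht']
    · rfl
    · simp [hright, hright', Real.zero_rpow hp.ne']
  have hleft (x : X ⊕ Unit) : hatKernel ωX z (Sum.inr (), x) = z := rfl
  have hleft' (y : Y ⊕ Unit) : hatKernel ωY z (Sum.inr (), y) = z := rfl
  have hinl (x x' : X) : hatKernel ωX z (Sum.inl x, Sum.inl x') = ωX (x, x') := rfl
  have hinl' (y y' : Y) : hatKernel ωY z (Sum.inl y, Sum.inl y') = ωY (y, y') := rfl
  unfold dis
  simp_rw [hinner]
  rw [hatCoupling, integral_smul_map_add_smul_dirac_of_apply_eq_zero he hs hse,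
    ENNReal.toReal_ofReal ht']
  · simp only [Prod.map_fst, Prod.map_snd, hinl, hinl']
    rw [integral_const_mul, ← mul_assoc, ← sq, Real.mul_rpow (sq_nonneg _)
      (integral_nonneg fun _ => integral_nonneg fun _ => Real.rpow_nonneg dist_nonneg _),
      ← Real.rpow_natCast, ← Real.rpow_mul ht']
    congr 2
    push_cast
    ring
  · simp [hleft, hleft', Real.zero_rpow hp.ne']

theorem dis_nonneg {X Y Z : Type*} [MeasurableSpace X] [MeasurableSpace Y]
    [PseudoMetricSpace Z] (p : ℝ) (ωX : X × X → Z) (ωY : Y × Y → Z) (π : Measure (X × Y)) :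
    0 ≤ dis p ωX ωY π :=
  Real.rpow_nonneg
    (integral_nonneg fun _ => integral_nonneg fun _ => Real.rpow_nonneg dist_nonneg _) _

theorem prod_mem_couplings {X Y : Type*} [MeasurableSpace X] [MeasurableSpace Y]
    (μ : Measure X) (ν : Measure Y) [IsProbabilityMeasure μ] [IsProbabilityMeasure ν] :
    μ.prod ν ∈ Couplings μ ν :=
  ⟨inferInstance, by simp, by simp⟩

/-- **Lipschitz contraction estimate**: with `X_t = (X ⊔ {⋆}, ω̂_X, (1−t)μX + tδ_⋆)` and
`Y_t` defined analogously, one has `GW_p^Z(X_t, Y_t) ≤ (1−t)^{2/p} · GW_p^Z(X, Y)`. -/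
theorem gw_contraction_estimate
    {X Y Z : Type*}
    [MeasurableSpace X] [TopologicalSpace X] [PolishSpace X] [BorelSpace X]
    [MeasurableSpace Y] [TopologicalSpace Y] [PolishSpace Y] [BorelSpace Y]
    [MetricSpace Z] [MeasurableSpace Z] [BorelSpace Z] [TopologicalSpace.SeparableSpace Z]
    (p : ℝ) (hp : 1 ≤ p) (z : Z) (t : ℝ) (ht : t ∈ Set.Icc (0 : ℝ) 1)
    (ωX : X × X → Z) (μX : Measure X) (hX : IsNetwork p ωX μX)
    (ωY : Y × Y → Z) (μY : Measure Y) (hY : IsNetwork p ωY μY) :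
    GW p (hatKernel ωX z) (mixDirac μX t) (hatKernel ωY z) (mixDirac μY t) ≤
      (1 - t) ^ (2 / p) * GW p ωX μX ωY μY := by
  have := hX.prob
  have := hY.prob
  have hne : (dis p ωX ωY '' Couplings μX μY).Nonempty :=
    ⟨_, _, prod_mem_couplings μX μY, rfl⟩
  have hc : 0 ≤ (1 - t) ^ (2 / p) := Real.rpow_nonneg (sub_nonneg.2 ht.2) _
  unfold GW
  rw [mul_left_comm]
  refine mul_le_mul_of_nonneg_left ?_ (by norm_num)
  rw [← smul_eq_mul (_ ^ _), ← Real.sInf_smul_of_nonneg hc]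
  refine le_csInf hne.smul_set ?_
  rintro _ ⟨_, ⟨π, hπ, rfl⟩, rfl⟩
  refine csInf_le ⟨0, ?_⟩ ⟨_, hatCoupling_mem_couplings hπ ht, ?_⟩
  · rintro _ ⟨π', -, rfl⟩
    exact dis_nonneg _ _ _ _
  · exact dis_hatCoupling (by linarith) z ht.2 ωX ωY π
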